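/- arXiv:2306.14833 — 2 statements merged into one kernel-verified Lean document; each statement's English description precedes it below -/
import Mathlib

section
/- Let F be a field and let D be a local subring of F whose prime spectrum Spec D is a Noetherian topological space. Let X be a projective model of F/D and let Y be a nonempty Zariski closed and connected subset of the set of local rings in X that dominate D. Then A(Y) is a local ring and every local ring α in Y dominates A(Y). -/
/-!
Common definitions: valuation rings of a field, the Zariski--Riemann space
`Zar_F(D)` with its Zariski and patch topologies, domination of local subrings,
residual algebraicity, integral closedness, and projective models of `F/D`.
-/

variable {F : Type*} [Field F]

/-- `x` lies in the maximal ideal (set of nonunits) of the (local) subring `R` of `F`. -/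
def MemMaxIdeal (R : Subring F) (x : F) : Prop :=
  ∃ h : x ∈ R, ¬ IsUnit (⟨x, h⟩ : R)

/-- The local ring `R` dominates the local ring `S` (both subrings of `F`):
`S ⊆ R` and the maximal ideal of `R` contracts to the maximal ideal of `S`. -/
def Dominates (R S : Subring F) : Prop :=
  S ≤ R ∧ ∀ x ∈ S, (MemMaxIdeal S x ↔ MemMaxIdeal R x)

/-- `V` is a valuation ring of the field `F`: for every nonzero `x ∈ F`,
`x ∈ V` or `x⁻¹ ∈ V`. -/
def IsValSubring (V : Subring F) : Prop :=
  ∀ x : F, x ≠ 0 → x ∈ V ∨ x⁻¹ ∈ V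

/-- `Zar_F(D)`: the valuation rings of `F` containing `D`. -/
def zarSet (D : Subring F) : Set (Subring F) :=
  {V | IsValSubring V ∧ D ≤ V}

/-- `Dom_F(D)`: the valuation rings of `F` dominating the local subring `D`. -/
def domSet (D : Subring F) : Set (Subring F) :=
  {V | IsValSubring V ∧ Dominates V D}

/-- The Zariski topology on a collection `X` of subrings of `F`, with basic open sets
`U(x₁,…,xₙ) = {R ∈ X : x₁,…,xₙ ∈ R}`. -/
def zariskiTop (X : Set (Subring F)) : TopologicalSpace X :=
  TopologicalSpace.generateFrom
    {U | ∃ s : Finset F, U = {R : X | ∀ x ∈ s, x ∈ (R : Subring F)}}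

/-- The patch topology on a collection `X` of subrings of `F`: generated by the
quasicompact Zariski-open sets together with their complements. -/
def patchTop (X : Set (Subring F)) : TopologicalSpace X :=
  TopologicalSpace.generateFrom
    ({U | @IsOpen _ (zariskiTop X) U ∧ @IsCompact _ (zariskiTop X) U} ∪
      {V | ∃ U, @IsOpen _ (zariskiTop X) U ∧ @IsCompact _ (zariskiTop X) U ∧ V = Uᶜ})

/-- `R` is residually algebraic over `D`: the residue field extension
`D/m_D → R/m_R` is algebraic, i.e. each element of `R` satisfies, modulo the
maximal ideal of `R`, a monic polynomial with coefficients in `D`. -/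
def ResiduallyAlgebraic (D R : Subring F) : Prop :=
  ∀ x ∈ R, ∃ p : Polynomial F, p.Monic ∧ (∀ i, p.coeff i ∈ D) ∧ MemMaxIdeal R (p.eval x)

/-- `R` is integrally closed in `F`: every element of `F` integral over `R` lies in `R`. -/
def IntegrallyClosedIn (R : Subring F) : Prop :=
  ∀ x : F, (∃ p : Polynomial F, p.Monic ∧ (∀ i, p.coeff i ∈ R) ∧ p.eval x = 0) → x ∈ R

/-- The localization of the subring `A` of `F` at the prime ideal `P`, viewed as the
subring of `F` generated by the fractions `a/b` with `a, b ∈ A`, `b ∉ P`. -/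
def localizationSubring (A : Subring F) (P : Ideal A) : Subring F :=
  Subring.closure {z : F | ∃ a b : A, b ∉ P ∧ z = (a : F) * (b : F)⁻¹}

/-- The ring `D[x₁/xᵢ, …, xₙ/xᵢ]`. -/
def modelChart (D : Subring F) {n : ℕ} (x : Fin n → F) (i : Fin n) : Subring F :=
  Subring.closure ((D : Set F) ∪ {y | ∃ j, y = x j * (x i)⁻¹})

/-- `X` is the projective model of `F/D` defined by some nonzero elements
`x₀, …, xₙ` of `F`: the set of all localizations of the rings
`D[x₀/xᵢ, …, xₙ/xᵢ]` at their prime ideals. -/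
def IsProjModel (D : Subring F) (X : Set (Subring F)) : Prop :=
  ∃ (n : ℕ) (x : Fin (n + 1) → F), (∀ i, x i ≠ 0) ∧
    X = {R | ∃ (i : Fin (n + 1)) (P : Ideal (modelChart D x i)),
          P.IsPrime ∧ R = localizationSubring (modelChart D x i) P}

/-- `X(Z)`: the members of the projective model `X` dominated by some valuation ring
in `Z`. -/
def modelImage (X Z : Set (Subring F)) : Set (Subring F) :=
  {α ∈ X | ∃ V ∈ Z, Dominates V α}

/-- `A(Y)`: the intersection of a collection `Y` of subrings of `F`, as a subset of `F`. -/
def ringsInter (Y : Set (Subring F)) : Set F :=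
  ⋂ R ∈ Y, (R : Set F)

section LocalSubrings

variable {R S D : Subring F} {x y : F}

lemma memMaxIdeal_iff : MemMaxIdeal R x ↔ x ∈ R ∧ ¬ (x ≠ 0 ∧ x⁻¹ ∈ R) := by
  constructor
  · rintro ⟨h, hu⟩
    refine ⟨h, fun ⟨h0, hi⟩ => hu ?_⟩
    exact IsUnit.of_mul_eq_one ⟨x⁻¹, hi⟩ (Subtype.ext (mul_inv_cancel₀ h0))
  · rintro ⟨h, hu⟩
    refine ⟨h, fun hx => hu ?_⟩
    obtain ⟨y, hy⟩ := hx.exists_right_inv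
    have hxy : x * (y : F) = 1 := congrArg Subtype.val hy
    exact ⟨left_ne_zero_of_mul_eq_one hxy, (eq_inv_of_mul_eq_one_right hxy) ▸ y.2⟩

lemma memMaxIdeal_zero : MemMaxIdeal R 0 := memMaxIdeal_iff.2 ⟨R.zero_mem, by simp⟩

lemma not_memMaxIdeal_one : ¬ MemMaxIdeal R 1 := fun h =>
  (memMaxIdeal_iff.1 h).2 (by simp [R.one_mem])

lemma MemMaxIdeal.not_inv_mem (h : MemMaxIdeal R x) (h0 : x ≠ 0) : x⁻¹ ∉ R :=
  fun hi => (memMaxIdeal_iff.1 h).2 ⟨h0, hi⟩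

lemma ne_zero_of_not_memMaxIdeal (h : ¬ MemMaxIdeal R x) : x ≠ 0 :=
  fun h0 => h (h0 ▸ memMaxIdeal_zero)

lemma inv_mem_of_not_memMaxIdeal (hx : x ∈ R) (h : ¬ MemMaxIdeal R x) : x⁻¹ ∈ R := by
  by_contra hi
  exact h (memMaxIdeal_iff.2 ⟨hx, fun h' => hi h'.2⟩)

lemma MemMaxIdeal.of_le (h : MemMaxIdeal S x) (hRS : R ≤ S) (hx : x ∈ R) : MemMaxIdeal R x :=
  memMaxIdeal_iff.2 ⟨hx, fun h' => (memMaxIdeal_iff.1 h).2 ⟨h'.1, hRS h'.2⟩⟩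

lemma MemMaxIdeal.mul_left (h : MemMaxIdeal R x) (hy : y ∈ R) : MemMaxIdeal R (y * x) :=
  ⟨R.mul_mem hy h.1, fun hu => h.2
    (isUnit_of_mul_isUnit_right (x := (⟨y, hy⟩ : R)) (y := ⟨x, h.1⟩) hu)⟩

lemma MemMaxIdeal.mul_right (h : MemMaxIdeal R x) (hy : y ∈ R) : MemMaxIdeal R (x * y) :=
  mul_comm y x ▸ h.mul_left hy

lemma MemMaxIdeal.add [IsLocalRing R] (hx : MemMaxIdeal R x) (hy : MemMaxIdeal R y) :
    MemMaxIdeal R (x + y) :=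
  ⟨R.add_mem hx.1 hy.1, IsLocalRing.nonunits_add (a := (⟨x, hx.1⟩ : R)) (b := ⟨y, hy.1⟩) hx.2 hy.2⟩

lemma MemMaxIdeal.neg (hx : MemMaxIdeal R x) : MemMaxIdeal R (-x) := by
  simpa using hx.mul_left (R.neg_mem R.one_mem)

lemma MemMaxIdeal.sub [IsLocalRing R] (hx : MemMaxIdeal R x) (hy : MemMaxIdeal R y) :
    MemMaxIdeal R (x - y) := by
  simpa [sub_eq_add_neg] using hx.add hy.neg

lemma eval₂_subtype_mem (hD : D ≤ R) (hx : x ∈ R) (p : Polynomial D) :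
    p.eval₂ D.subtype x ∈ R := by
  rw [Polynomial.eval₂_eq_sum]
  exact R.sum_mem fun i _ => R.mul_mem (hD (p.coeff i).2) (R.pow_mem hx i)

lemma MemMaxIdeal.eval₂_of_coeff [IsLocalRing R] (hdom : Dominates R D) (hx : x ∈ R)
    {p : Polynomial D} (hp : ∀ i, MemMaxIdeal D (p.coeff i : F)) :
    MemMaxIdeal R (p.eval₂ D.subtype x) := by
  rw [Polynomial.eval₂_eq_sum, Polynomial.sum]
  refine Finset.sum_induction _ (MemMaxIdeal R) (fun _ _ => MemMaxIdeal.add) memMaxIdeal_zero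
    fun i _ => ?_
  exact ((hdom.2 _ (p.coeff i).2).1 (hp i)).mul_right (R.pow_mem hx i)

end LocalSubrings

section Localization

variable {A : Subring F} {P Q : Ideal A}

lemma mem_localizationSubring [P.IsPrime] {z : F} :
    z ∈ localizationSubring A P ↔ ∃ a b : A, b ∉ P ∧ z = (a : F) * (b : F)⁻¹ := by
  have hne : ∀ b : A, b ∉ P → (b : F) ≠ 0 := fun b hb h0 =>
    hb ((Subtype.ext h0 : b = 0) ▸ P.zero_mem)
  have h1 : (1 : A) ∉ P := fun h => Ideal.IsPrime.ne_top ‹_› ((Ideal.eq_top_iff_one P).2 h)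
  have hmul : ∀ {b d : A}, b ∉ P → d ∉ P → b * d ∉ P := fun hb hd h =>
    (Ideal.IsPrime.mem_or_mem ‹_› h).elim hb hd
  constructor
  · intro hz
    refine Subring.closure_induction (p := fun z _ => ∃ a b : A, b ∉ P ∧ z = (a : F) * (b : F)⁻¹)
      (fun _ h => h) ⟨0, 1, h1, by simp⟩ ⟨1, 1, h1, by simp⟩ ?_ ?_ ?_ hz
    · rintro _ _ _ _ ⟨a, b, hb, rfl⟩ ⟨c, d, hd, rfl⟩
      refine ⟨a * d + c * b, b * d, hmul hb hd, ?_⟩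
      have := hne b hb
      have := hne d hd
      push_cast
      field_simp
    · rintro _ _ ⟨a, b, hb, rfl⟩
      exact ⟨-a, b, hb, by push_cast; ring⟩
    · rintro _ _ _ _ ⟨a, b, hb, rfl⟩ ⟨c, d, hd, rfl⟩
      refine ⟨a * c, b * d, hmul hb hd, ?_⟩
      push_cast
      rw [mul_inv]
      ring
  · exact fun h => Subring.subset_closure h

lemma le_localizationSubring [P.IsPrime] : A ≤ localizationSubring A P := fun z hz =>
  mem_localizationSubring.2 ⟨⟨z, hz⟩, 1,
    fun h => Ideal.IsPrime.ne_top ‹_› ((Ideal.eq_top_iff_one P).2 h), by simp⟩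

lemma localizationSubring_le {S : Subring F} [P.IsPrime] (hA : A ≤ S)
    (hP : ∀ b : A, b ∉ P → (b : F)⁻¹ ∈ S) : localizationSubring A P ≤ S := by
  intro z hz
  obtain ⟨a, b, hb, rfl⟩ := mem_localizationSubring.1 hz
  exact S.mul_mem (hA a.2) (hP b hb)

lemma inv_mem_localizationSubring [P.IsPrime] {b : A} (hb : b ∉ P) :
    (b : F)⁻¹ ∈ localizationSubring A P :=
  mem_localizationSubring.2 ⟨1, b, hb, by simp⟩

lemma localizationSubring_anti [P.IsPrime] [Q.IsPrime] (h : P ≤ Q) :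
    localizationSubring A Q ≤ localizationSubring A P :=
  localizationSubring_le le_localizationSubring fun _ hb =>
    inv_mem_localizationSubring fun hP => hb (h hP)

lemma memMaxIdeal_localizationSubring [P.IsPrime] {z : F} :
    MemMaxIdeal (localizationSubring A P) z ↔ ∃ a b : A, a ∈ P ∧ b ∉ P ∧ z = a * (b : F)⁻¹ := by
  have hne : ∀ b : A, b ∉ P → (b : F) ≠ 0 := fun b hb h0 =>
    hb ((Subtype.ext h0 : b = 0) ▸ P.zero_mem)
  rw [memMaxIdeal_iff]
  constructor
  · rintro ⟨hz, hu⟩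
    obtain ⟨a, b, hb, rfl⟩ := mem_localizationSubring.1 hz
    refine ⟨a, b, ?_, hb, rfl⟩
    by_contra ha
    refine hu ⟨mul_ne_zero (hne a ha) (inv_ne_zero (hne b hb)), ?_⟩
    exact mem_localizationSubring.2 ⟨b, a, ha, by rw [mul_inv, inv_inv, mul_comm]⟩
  · rintro ⟨a, b, ha, hb, rfl⟩
    refine ⟨mem_localizationSubring.2 ⟨a, b, hb, rfl⟩, ?_⟩
    rintro ⟨h0, hi⟩
    obtain ⟨c, d, hd, h⟩ := mem_localizationSubring.1 hi
    have hb0 := hne b hb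
    have hd0 := hne d hd
    have ha0 : (a : F) ≠ 0 := left_ne_zero_of_mul h0
    have : b * d = a * c := by
      apply Subtype.ext
      push_cast
      rw [mul_inv, inv_inv] at h
      field_simp at h
      linear_combination h
    exact ((Ideal.IsPrime.mem_or_mem ‹_› (this ▸ P.mul_mem_right c ha)).elim hb hd)

lemma coe_memMaxIdeal_localizationSubring [P.IsPrime] {a : A} :
    MemMaxIdeal (localizationSubring A P) (a : F) ↔ a ∈ P := by
  constructor
  · intro h
    by_contra ha
    exact (memMaxIdeal_iff.1 h).2 ⟨fun h0 => ha ((Subtype.ext h0 : a = 0) ▸ P.zero_mem),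
      inv_mem_localizationSubring ha⟩
  · exact fun h => memMaxIdeal_localizationSubring.2 ⟨a, 1, h,
      fun h => Ideal.IsPrime.ne_top ‹_› ((Ideal.eq_top_iff_one P).2 h), by simp⟩

instance isLocalRing_localizationSubring [P.IsPrime] : IsLocalRing (localizationSubring A P) := by
  refine IsLocalRing.of_nonunits_add fun x y hx hy hxy => ?_
  obtain ⟨a, b, ha, hb, hab⟩ := memMaxIdeal_localizationSubring.1 ⟨x.2, hx⟩
  obtain ⟨c, d, hc, hd, hcd⟩ := memMaxIdeal_localizationSubring.1 ⟨y.2, hy⟩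
  have hne : ∀ b : A, b ∉ P → (b : F) ≠ 0 := fun b hb h0 =>
    hb ((Subtype.ext h0 : b = 0) ▸ P.zero_mem)
  have hm : MemMaxIdeal (localizationSubring A P) ((x + y : localizationSubring A P) : F) := by
    refine memMaxIdeal_localizationSubring.2 ⟨a * d + c * b, b * d,
      P.add_mem (P.mul_mem_right _ ha) (P.mul_mem_right _ hc),
      fun h => (Ideal.IsPrime.mem_or_mem ‹_› h).elim hb hd, ?_⟩
    have := hne b hb
    have := hne d hd
    push_cast
    rw [hab, hcd]
    field_simp
  exact hm.2 hxy

lemma continuous_localizationSubring {X : Set (Subring F)}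
    (hX : ∀ P : PrimeSpectrum A, localizationSubring A P.asIdeal ∈ X) :
    @Continuous _ _ _ (zariskiTop X)
      (fun P : PrimeSpectrum A => (⟨localizationSubring A P.asIdeal, hX P⟩ : X)) := by
  refine continuous_generateFrom_iff.2 ?_
  rintro _ ⟨s, rfl⟩
  have : (fun P : PrimeSpectrum A => (⟨localizationSubring A P.asIdeal, hX P⟩ : X)) ⁻¹'
      {R : X | ∀ z ∈ s, z ∈ (R : Subring F)} =
      ⋂ z ∈ s, ⋃ b ∈ {b : A | (b : F) ≠ 0 ∧ ∃ a : A, z = a * (b : F)⁻¹},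
        (PrimeSpectrum.basicOpen b : Set (PrimeSpectrum A)) := by
    ext P
    simp only [Set.mem_preimage, Set.mem_ofPred_eq, Set.mem_iInter, Set.mem_iUnion,
      mem_localizationSubring, SetLike.mem_coe, PrimeSpectrum.mem_basicOpen]
    refine forall₂_congr fun z _ => ⟨?_, ?_⟩
    · rintro ⟨a, b, hb, h⟩
      exact ⟨b, ⟨fun h0 => hb ((Subtype.ext h0 : b = 0) ▸ P.asIdeal.zero_mem), a, h⟩, hb⟩
    · rintro ⟨b, ⟨-, a, h⟩, hb⟩
      exact ⟨a, b, hb, h⟩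
  rw [this]
  exact isOpen_biInter_finset fun z _ => isOpen_biUnion fun b _ =>
    (PrimeSpectrum.basicOpen b).isOpen

end Localization

section Center

variable {D A S : Subring F}

/-- The center of a local ring `S` on a subring `A`. -/
def centerIdeal [IsLocalRing S] (h : A ≤ S) : Ideal A :=
  (IsLocalRing.maximalIdeal S).comap (Subring.inclusion h)

instance centerIdeal_isPrime [IsLocalRing S] (h : A ≤ S) : (centerIdeal h).IsPrime :=
  Ideal.comap_isPrime _ _

lemma mem_centerIdeal [IsLocalRing S] (h : A ≤ S) {a : A} :
    a ∈ centerIdeal h ↔ MemMaxIdeal S (a : F) := by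
  constructor
  · exact fun ha => ⟨h a.2, (IsLocalRing.mem_maximalIdeal _).1 ha⟩
  · exact fun ⟨_, ha⟩ => (IsLocalRing.mem_maximalIdeal _).2 ha

lemma localizationSubring_centerIdeal_le [IsLocalRing S] (h : A ≤ S) :
    localizationSubring A (centerIdeal h) ≤ S :=
  localizationSubring_le h fun b hb =>
    inv_mem_of_not_memMaxIdeal (h b.2) fun hm => hb ((mem_centerIdeal h).2 hm)

lemma modelChart_le {n : ℕ} {x : Fin n → F} {i : Fin n} (hD : D ≤ S)
    (hx : ∀ j, x j * (x i)⁻¹ ∈ S) : modelChart D x i ≤ S := by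
  refine Subring.closure_le.2 (Set.union_subset hD ?_)
  rintro _ ⟨j, rfl⟩
  exact hx j

lemma le_modelChart {n : ℕ} {x : Fin n → F} {i : Fin n} : D ≤ modelChart D x i :=
  fun _ h => Subring.subset_closure (Or.inl h)

lemma div_mem_modelChart {n : ℕ} {x : Fin n → F} {i : Fin n} (j : Fin n) :
    x j * (x i)⁻¹ ∈ modelChart D x i :=
  Subring.subset_closure (Or.inr ⟨j, rfl⟩)

lemma exists_modelChart_le (V : ValuationSubring F) (hD : D ≤ V.toSubring) {n : ℕ}
    (x : Fin (n + 1) → F) : ∃ i, modelChart D x i ≤ V.toSubring := by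
  obtain ⟨i, hi⟩ := Finite.exists_max fun i => V.valuation (x i)
  refine ⟨i, modelChart_le hD fun j => ?_⟩
  refine (V.valuation_le_one_iff _).1 ?_
  rw [map_mul, map_inv₀]
  exact mul_inv_le_one_of_le₀ (hi j) zero_le

end Center

section ResiduallyTranscendental

variable {D α : Subring F}

lemma exists_valuationSubring_of_forall_monic [IsLocalRing D] [IsLocalRing α]
    (hdom : Dominates α D) {f : F} (hf : f ∈ α)
    (htr : ∀ p : Polynomial D, p.Monic → ¬ MemMaxIdeal α (p.eval₂ D.subtype f)) :
    ∃ V : ValuationSubring F, D ≤ V.toSubring ∧ (∀ y, MemMaxIdeal D y → MemMaxIdeal V.toSubring y) ∧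
      (∀ y, MemMaxIdeal α y → MemMaxIdeal V.toSubring y) ∧ f ∉ V := by
  have hfm : ¬ MemMaxIdeal α f := by simpa using htr Polynomial.X Polynomial.monic_X
  have hf0 : f ≠ 0 := ne_zero_of_not_memMaxIdeal hfm
  have hg : f⁻¹ ∈ α := inv_mem_of_not_memMaxIdeal hf hfm
  have hev : ∀ q : Polynomial D, q.eval₂ D.subtype f⁻¹ ∈ α := eval₂_subtype_mem hdom.1 hg
  have hmem : ∀ (q : Polynomial D) y, MemMaxIdeal α (y - q.eval₂ D.subtype f⁻¹) → y ∈ α :=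
    fun q y h => by simpa using α.add_mem h.1 (hev q)
  have hmul : ∀ (p q : Polynomial D) y z, MemMaxIdeal α (y - p.eval₂ D.subtype f⁻¹) →
      MemMaxIdeal α (z - q.eval₂ D.subtype f⁻¹) →
      MemMaxIdeal α (y * z - (p * q).eval₂ D.subtype f⁻¹) := fun p q y z hy hz => by
    convert (hz.mul_left (hmem p y hy)).add (hy.mul_right (hev q)) using 1
    rw [Polynomial.eval₂_mul]
    ring
  have hadd : ∀ (p q : Polynomial D) y z, MemMaxIdeal α (y - p.eval₂ D.subtype f⁻¹) →
      MemMaxIdeal α (z - q.eval₂ D.subtype f⁻¹) →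
      MemMaxIdeal α (y + z - (p + q).eval₂ D.subtype f⁻¹) := fun p q y z hy hz => by
    convert hy.add hz using 1
    rw [Polynomial.eval₂_add]
    ring
  let B : Subring F :=
    { carrier := {y | ∃ q : Polynomial D, MemMaxIdeal α (y - q.eval₂ D.subtype f⁻¹)}
      zero_mem' := ⟨0, by simpa using memMaxIdeal_zero⟩
      one_mem' := ⟨1, by simpa using memMaxIdeal_zero⟩
      add_mem' := fun ⟨p, hp⟩ ⟨q, hq⟩ => ⟨p + q, hadd p q _ _ hp hq⟩
      mul_mem' := fun ⟨p, hp⟩ ⟨q, hq⟩ => ⟨p * q, hmul p q _ _ hp hq⟩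
      neg_mem' := fun {y} ⟨p, hp⟩ => ⟨-p, by
        convert hp.neg using 1
        rw [Polynomial.eval₂_neg]
        ring⟩ }
  let I : Ideal B :=
    { carrier := {y | ∃ q : Polynomial D, MemMaxIdeal D (q.coeff 0 : F) ∧
        MemMaxIdeal α ((y : F) - q.eval₂ D.subtype f⁻¹)}
      zero_mem' := ⟨0, by simpa using memMaxIdeal_zero, by simpa using memMaxIdeal_zero⟩
      add_mem' := fun ⟨p, hp0, hp⟩ ⟨q, hq0, hq⟩ =>
        ⟨p + q, by simpa using hp0.add hq0, hadd p q _ _ hp hq⟩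
      smul_mem' := fun c y ⟨q, hq0, hq⟩ => by
        obtain ⟨p, hp⟩ := c.2
        exact ⟨p * q, by
          rw [Polynomial.mul_coeff_zero]
          exact hq0.mul_left (p.coeff 0).2, hmul p q _ _ hp hq⟩ }
  have hI : I ≠ ⊤ := by
    rw [Ne, Ideal.eq_top_iff_one]
    rintro ⟨q, hq0, hq⟩
    set r : Polynomial D := 1 - q with hr
    have hr0 : IsUnit (r.coeff 0) := by
      by_contra hu
      have h1 : MemMaxIdeal D (r.coeff 0 : F) := ⟨_, hu⟩
      have h2 := h1.add hq0
      simp [hr] at h2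
      exact not_memMaxIdeal_one h2
    have hre : MemMaxIdeal α (r.eval₂ D.subtype f⁻¹) := by
      simpa [hr, Polynomial.eval₂_sub] using hq
    obtain ⟨u, hu⟩ := hr0
    have hlead : r.reverse.leadingCoeff = u := by
      rw [Polynomial.reverse_leadingCoeff,
        Polynomial.trailingCoeff_eq_coeff_zero (hu ▸ u.ne_zero), hu]
    refine htr (Polynomial.C ((u⁻¹ : Dˣ) : D) * r.reverse) ?_ ?_
    · rw [Polynomial.Monic, Polynomial.leadingCoeff_mul, Polynomial.leadingCoeff_C, hlead,
        Units.inv_mul]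
    · rw [Polynomial.eval₂_mul, Polynomial.eval₂_C]
      refine MemMaxIdeal.mul_left ?_ (hdom.1 (Subtype.prop _))
      let _ : Invertible f⁻¹ := invertibleOfNonzero (inv_ne_zero hf0)
      have h := Polynomial.eval₂_reverse_mul_pow D.subtype f⁻¹ r
      rw [invOf_eq_inv, inv_inv] at h
      have h' : r.reverse.eval₂ D.subtype f = r.eval₂ D.subtype f⁻¹ * f ^ r.natDegree := by
        rw [← h, mul_assoc, ← mul_pow, inv_mul_cancel₀ hf0, one_pow, mul_one]
      rw [h']
      exact hre.mul_right (α.pow_mem hf _)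
  obtain ⟨V, hBV, hIV⟩ := Ideal.image_subset_nonunits_valuationSubring I hI
  have key : ∀ (y : F) (q : Polynomial D), MemMaxIdeal D (q.coeff 0 : F) →
      MemMaxIdeal α (y - q.eval₂ D.subtype f⁻¹) → MemMaxIdeal V.toSubring y := by
    intro y q h0 hy
    have hyB : y ∈ B := ⟨q, hy⟩
    have hyn : y ∈ V.nonunits := hIV ⟨⟨y, hyB⟩, ⟨q, h0, hy⟩, rfl⟩
    refine memMaxIdeal_iff.2 ⟨hBV hyB, fun ⟨hy0, hyi⟩ => ?_⟩
    have h1 : V.valuation y < 1 := V.mem_nonunits_iff.1 hyn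
    have h2 : V.valuation y⁻¹ ≤ 1 := (V.valuation_le_one_iff _).2 hyi
    rw [map_inv₀, inv_le_one₀ (by simpa [zero_lt_iff] using hy0)] at h2
    exact absurd h1 h2.not_gt
  refine ⟨V, fun y hy => hBV ⟨Polynomial.C ⟨y, hy⟩, ?_⟩, fun y hy => ?_, fun y hy => ?_, ?_⟩
  · simpa using memMaxIdeal_zero
  · refine key y (Polynomial.C ⟨y, hy.1⟩) (by simpa using hy) ?_
    simpa using memMaxIdeal_zero
  · exact key y 0 (by simpa using memMaxIdeal_zero) (by simpa using hy)
  · intro hfV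
    have := key f⁻¹ Polynomial.X (by simpa using memMaxIdeal_zero) (by simpa using memMaxIdeal_zero)
    exact this.not_inv_mem (inv_ne_zero hf0) (by rwa [inv_inv])

/-- A function that is residually transcendental at a point of a projective model has a pole at
some specialization of that point. -/
lemma exists_specialization_not_mem [IsLocalRing D] {X : Set (Subring F)} (hX : IsProjModel D X)
    (hα : α ∈ X) (hdom : Dominates α D) {f : F} (hf : f ∈ α)
    (htr : ∀ p : Polynomial D, p.Monic → ¬ MemMaxIdeal α (p.eval₂ D.subtype f)) :
    ∃ β ∈ X, Dominates β D ∧ β ≤ α ∧ f ∉ β := by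
  obtain ⟨n, x, hx, rfl⟩ := hX
  obtain ⟨k, P, hP, rfl⟩ := hα
  obtain ⟨V, hDV, hmD, hmα, hfV⟩ := exists_valuationSubring_of_forall_monic hdom hf htr
  have : IsLocalRing V.toSubring := inferInstanceAs (IsLocalRing V)
  obtain ⟨i, hi⟩ := exists_modelChart_le V hDV x
  set α := localizationSubring (modelChart D x k) P
  have hkα : modelChart D x k ≤ α := le_localizationSubring
  have hik : x i * (x k)⁻¹ ∈ α := hkα (div_mem_modelChart i)
  have hki : x k * (x i)⁻¹ ∈ α := by
    by_contra hc
    have hm : MemMaxIdeal α (x i * (x k)⁻¹) := memMaxIdeal_iff.2 ⟨hik, fun h => hc (by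
      simpa [mul_comm] using h.2)⟩
    refine (hmα _ hm).not_inv_mem (mul_ne_zero (hx i) (inv_ne_zero (hx k))) ?_
    have := hi (div_mem_modelChart (D := D) k)
    simpa [mul_comm] using this
  have hiα : modelChart D x i ≤ α := by
    refine modelChart_le hdom.1 fun j => ?_
    have := α.mul_mem (hkα (div_mem_modelChart j)) hki
    have hk := hx k
    rwa [mul_assoc, inv_mul_cancel_left₀ hk] at this
  have hβV := localizationSubring_centerIdeal_le hi
  refine ⟨_, ⟨i, centerIdeal hi, inferInstance, rfl⟩, ⟨?_, fun y hy => ⟨fun h => ?_, fun h => ?_⟩⟩,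
    ?_, fun h => hfV (hβV h)⟩
  · exact le_modelChart.trans le_localizationSubring
  · exact (hmD y h).of_le hβV (le_localizationSubring (le_modelChart hy))
  · exact h.of_le (le_modelChart.trans le_localizationSubring) hy
  · refine localizationSubring_le hiα fun b hb => inv_mem_of_not_memMaxIdeal (hiα b.2) fun hm => ?_
    exact hb ((mem_centerIdeal hi).2 (hmα _ hm))

end ResiduallyTranscendental

section Finiteness

lemma exists_finite_minimal_of_isClosed {R : Type*} [CommRing R] {Z : Set (PrimeSpectrum R)}
    (hZ : IsClosed Z) (hN : IsNoetherianRing (R ⧸ PrimeSpectrum.vanishingIdeal Z)) :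
    ∃ T : Set (PrimeSpectrum R), T.Finite ∧ T ⊆ Z ∧ ∀ P ∈ Z, ∃ Q ∈ T, Q.asIdeal ≤ P.asIdeal := by
  set I := PrimeSpectrum.vanishingIdeal Z with hI
  have hZI : PrimeSpectrum.zeroLocus (I : Set R) = Z := by
    rw [hI, PrimeSpectrum.zeroLocus_vanishingIdeal_eq_closure, hZ.closure_eq]
  have hfin : I.minimalPrimes.Finite := by
    rw [Ideal.minimalPrimes_eq_comap]
    exact (minimalPrimes.finite_of_isNoetherianRing (R ⧸ I)).image _
  refine ⟨PrimeSpectrum.asIdeal ⁻¹' I.minimalPrimes,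
    hfin.preimage fun P _ Q _ h => PrimeSpectrum.ext h, fun P hP => ?_, fun P hP => ?_⟩
  · rw [← hZI]
    exact hP.1.2
  · have hIP : I ≤ P.asIdeal := by
      rw [← hZI] at hP
      exact hP
    obtain ⟨Q, hQ, hQP⟩ := Ideal.exists_minimalPrimes_le hIP
    exact ⟨⟨Q, hQ.1.1⟩, hQ, hQP⟩

variable {D : Subring F} {n : ℕ} {x : Fin n → F} {i : Fin n}

lemma isNoetherianRing_modelChart_quotient [IsLocalRing D] (I : Ideal (modelChart D x i))
    (hI : ∀ a : modelChart D x i, MemMaxIdeal D (a : F) → a ∈ I) :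
    IsNoetherianRing (modelChart D x i ⧸ I) := by
  let φ : IsLocalRing.ResidueField D →+* modelChart D x i ⧸ I :=
    Ideal.Quotient.lift (IsLocalRing.maximalIdeal D)
      ((Ideal.Quotient.mk I).comp (Subring.inclusion le_modelChart)) fun a ha =>
        Ideal.Quotient.eq_zero_iff_mem.2 (hI _ ⟨a.2, (IsLocalRing.mem_maximalIdeal _).1 ha⟩)
  let ψ : MvPolynomial (Fin n) (IsLocalRing.ResidueField D) →+* modelChart D x i ⧸ I :=
    MvPolynomial.eval₂Hom φ fun j => Ideal.Quotient.mk I ⟨_, div_mem_modelChart j⟩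
  refine isNoetherianRing_of_surjective _ _ ψ fun z => ?_
  obtain ⟨⟨z, hz⟩, rfl⟩ := Ideal.Quotient.mk_surjective z
  refine Subring.closure_induction
    (p := fun z hz => ∃ m, ψ m = Ideal.Quotient.mk I (⟨z, hz⟩ : modelChart D x i))
    ?_ ⟨0, ?_⟩ ⟨1, ?_⟩ ?_ ?_ ?_ hz
  · rintro y (hy | ⟨j, rfl⟩)
    · refine ⟨MvPolynomial.C (IsLocalRing.residue D ⟨y, hy⟩), ?_⟩
      rw [MvPolynomial.coe_eval₂Hom, MvPolynomial.eval₂_C]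
      rfl
    · exact ⟨MvPolynomial.X j, MvPolynomial.eval₂_X _ _ _⟩
  · rw [map_zero]
    exact (map_zero _).symm
  · rw [map_one]
    exact (map_one _).symm
  · rintro y z _ _ ⟨p, hp⟩ ⟨q, hq⟩
    exact ⟨p + q, by rw [map_add, hp, hq, ← map_add]; rfl⟩
  · rintro y _ ⟨p, hp⟩
    exact ⟨-p, by rw [map_neg, hp, ← map_neg]; rfl⟩
  · rintro y z _ _ ⟨p, hp⟩ ⟨q, hq⟩
    exact ⟨p * q, by rw [map_mul, hp, hq, ← map_mul]; rfl⟩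

lemma isClosed_setOf_dominates_localizationSubring {A : Subring F} [IsLocalRing D] (hDA : D ≤ A) :
    IsClosed {P : PrimeSpectrum A | Dominates (localizationSubring A P.asIdeal) D} := by
  have : {P : PrimeSpectrum A | Dominates (localizationSubring A P.asIdeal) D} =
      PrimeSpectrum.zeroLocus {a : A | MemMaxIdeal D (a : F)} := by
    ext P
    constructor
    · exact fun h a ha => coe_memMaxIdeal_localizationSubring.1 ((h.2 _ ha.1).1 ha)
    · intro h
      have hDL : D ≤ localizationSubring A P.asIdeal := hDA.trans le_localizationSubring
      exact ⟨hDL, fun y hy => ⟨fun hm =>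
        coe_memMaxIdeal_localizationSubring (a := ⟨y, hDA hy⟩).2 (h hm), fun hm => hm.of_le hDL hy⟩⟩
  rw [this]
  exact PrimeSpectrum.isClosed_zeroLocus _

/-- A closed subset of the closed fibre of a projective model has finitely many generic points. -/
lemma exists_finset_generic [IsLocalRing D] {X : Set (Subring F)} (hX : IsProjModel D X)
    {C : Set X} (hC : @IsClosed _ (zariskiTop X) C) :
    ∃ T : Finset (Subring F),
      (∀ η ∈ T, ∃ h : η ∈ X, (⟨η, h⟩ : X) ∈ C ∩ {α : X | Dominates α.1 D}) ∧
      ∀ α ∈ C ∩ {α : X | Dominates α.1 D}, ∃ η ∈ T, α.1 ≤ η := by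
  classical
  obtain ⟨n, x, hx, hXeq⟩ := hX
  have hmem : ∀ i (P : PrimeSpectrum (modelChart D x i)), localizationSubring _ P.asIdeal ∈ X :=
    fun i P => hXeq ▸ ⟨i, P.asIdeal, P.isPrime, rfl⟩
  let Z : ∀ i, Set (PrimeSpectrum (modelChart D x i)) := fun i =>
    (fun P => (⟨localizationSubring _ P.asIdeal, hmem i P⟩ : X)) ⁻¹'
      (C ∩ {α : X | Dominates α.1 D})
  have hZ : ∀ i, IsClosed (Z i) := fun i =>
    (@IsClosed.preimage _ _ _ (zariskiTop X) _ (continuous_localizationSubring (hmem i)) _ hC).inter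
      (isClosed_setOf_dominates_localizationSubring le_modelChart)
  have hex := fun i => exists_finite_minimal_of_isClosed (hZ i)
    (isNoetherianRing_modelChart_quotient _ fun a ha =>
      (PrimeSpectrum.mem_vanishingIdeal _ _).2 fun P hP =>
        coe_memMaxIdeal_localizationSubring.1 ((hP.2.2 _ ha.1).1 ha))
  choose T hTfin hTZ hT using hex
  refine ⟨Finset.univ.biUnion fun i =>
    (hTfin i).toFinset.image fun P => localizationSubring _ P.asIdeal, fun η hη => ?_, ?_⟩
  · simp only [Finset.mem_biUnion, Finset.mem_univ, true_and, Finset.mem_image,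
      Set.Finite.mem_toFinset] at hη
    obtain ⟨i, P, hP, rfl⟩ := hη
    exact ⟨hmem i P, hTZ i hP⟩
  · rintro ⟨α, hαX⟩ hα
    obtain ⟨i, P, hP, rfl⟩ : ∃ i P, P.IsPrime ∧ α = localizationSubring (modelChart D x i) P := by
      have h := hαX
      rwa [hXeq] at h
    have := hP
    obtain ⟨Q, hQ, hQP⟩ := hT i ⟨P, hP⟩ hα
    refine ⟨localizationSubring _ Q.asIdeal, ?_, localizationSubring_anti hQP⟩
    simp only [Finset.mem_biUnion, Finset.mem_univ, true_and, Finset.mem_image,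
      Set.Finite.mem_toFinset]
    exact ⟨i, Q, hQ, rfl⟩

end Finiteness

section ClosedFibre

variable {D : Subring F} {X : Set (Subring F)}

lemma isOpen_zariskiTop_setOf_mem (y : F) :
    @IsOpen _ (zariskiTop X) {α : X | y ∈ (α : Subring F)} :=
  TopologicalSpace.isOpen_generateFrom_of_mem ⟨{y}, by simp⟩

lemma mem_of_isClosed_of_le {C : Set X} (hC : @IsClosed _ (zariskiTop X) C) {α β : X}
    (hα : α ∈ C) (h : β.1 ≤ α.1) : β ∈ C := by
  by_contra hβ
  have key : ∀ U : Set X, TopologicalSpace.GenerateOpen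
      {U : Set X | ∃ s : Finset F, U = {R : X | ∀ x ∈ s, x ∈ (R : Subring F)}} U →
      β ∈ U → α ∈ U := by
    intro U hU
    induction hU with
    | basic U hU =>
      obtain ⟨s, rfl⟩ := hU
      exact fun hs y hy => h (hs y hy)
    | univ => exact fun _ => trivial
    | inter U V _ _ hU hV => exact fun hβ => ⟨hU hβ.1, hV hβ.2⟩
    | sUnion S _ hS => exact fun ⟨U, hU, hβ⟩ => ⟨U, hU, hS U hU hβ⟩
  exact key Cᶜ (@IsClosed.isOpen_compl _ (zariskiTop X) _ hC) hβ hα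

lemma IsProjModel.isLocalRing (hX : IsProjModel D X) {α : Subring F} (hα : α ∈ X) :
    IsLocalRing α := by
  obtain ⟨n, x, -, rfl⟩ := hX
  obtain ⟨i, P, hP, rfl⟩ := hα
  infer_instance

lemma exists_monic_forall_memMaxIdeal [IsLocalRing D] (hX : IsProjModel D X) {C : Set X}
    (hC : @IsClosed _ (zariskiTop X) C) {f : F}
    (hf : ∀ α ∈ C ∩ {α : X | Dominates α.1 D}, f ∈ α.1) :
    ∃ p : Polynomial D, p.Monic ∧
      ∀ α ∈ C ∩ {α : X | Dominates α.1 D}, MemMaxIdeal α.1 (p.eval₂ D.subtype f) := by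
  classical
  obtain ⟨T, hTY, hT⟩ := exists_finset_generic hX hC
  have hpt : ∀ η : Subring F, ∃ p : Polynomial D, p.Monic ∧
      (η ∈ T → MemMaxIdeal η (p.eval₂ D.subtype f)) := by
    intro η
    by_cases hη : η ∈ T
    · obtain ⟨hηX, hηY⟩ := hTY η hη
      have := hX.isLocalRing hηX
      by_contra! hc
      obtain ⟨β, hβX, hβD, hβη, hfβ⟩ := exists_specialization_not_mem hX hηX hηY.2
        (hf _ hηY) fun p hp => (hc p hp).2
      exact hfβ (hf ⟨β, hβX⟩ ⟨mem_of_isClosed_of_le hC hηY.1 hβη, hβD⟩)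
    · exact ⟨1, Polynomial.monic_one, fun h => absurd h hη⟩
  choose p hpm hp using hpt
  refine ⟨∏ η ∈ T, p η, Polynomial.monic_prod_of_monic _ _ fun η _ => hpm η, fun α hα => ?_⟩
  obtain ⟨η, hη, hαη⟩ := hT α hα
  rw [← Finset.mul_prod_erase _ _ hη, Polynomial.eval₂_mul]
  have hev := fun q => eval₂_subtype_mem (p := q) hα.2.1 (hf α hα)
  exact ((hp η hη).of_le hαη (hev _)).mul_right (hev _)

/-- On a connected closed subset of the closed fibre, an everywhere regular function that is
a nonunit at one point is a nonunit at every point. -/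
lemma memMaxIdeal_of_isPreconnected [IsLocalRing D] (hX : IsProjModel D X) {C : Set X}
    (hC : @IsClosed _ (zariskiTop X) C)
    (hconn : @IsPreconnected _ (zariskiTop X) (C ∩ {α : X | Dominates α.1 D})) {f : F}
    (hf : ∀ α ∈ C ∩ {α : X | Dominates α.1 D}, f ∈ α.1) {α β : X}
    (hα : α ∈ C ∩ {α : X | Dominates α.1 D}) (hβ : β ∈ C ∩ {α : X | Dominates α.1 D})
    (hfα : MemMaxIdeal α.1 f) : MemMaxIdeal β.1 f := by
  classical
  obtain ⟨p, hpm, hp⟩ := exists_monic_forall_memMaxIdeal hX hC hf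
  by_contra hfβ
  have hf0 : f ≠ 0 := ne_zero_of_not_memMaxIdeal hfβ
  have hex : ∃ e, ¬ MemMaxIdeal D (p.coeff e : F) :=
    ⟨p.natDegree, by
      rw [hpm.coeff_natDegree]
      exact not_memMaxIdeal_one⟩
  set e := Nat.find hex
  have he : ¬ MemMaxIdeal D (p.coeff e : F) := Nat.find_spec hex
  let q : Polynomial D := Polynomial.divX^[e] p
  have hdiv : ∀ (k : ℕ) (r : Polynomial D) m,
      (Polynomial.divX^[k] r).coeff m = r.coeff (m + k) := by
    intro k
    induction k with
    | zero => simp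
    | succ k ih =>
      intro r m
      rw [Function.iterate_succ_apply', Polynomial.coeff_divX, ih]
      congr 1
      ring
  have hlow : ∀ m, MemMaxIdeal D ((p - Polynomial.X ^ e * q).coeff m : F) := by
    intro m
    rw [Polynomial.coeff_sub, Polynomial.coeff_X_pow_mul']
    split_ifs with hm
    · rw [hdiv, Nat.sub_add_cancel hm, sub_self]
      exact memMaxIdeal_zero
    · rw [sub_zero]
      exact not_not.1 (Nat.find_min hex (not_le.1 hm))
  have hq0 : q.coeff 0 = p.coeff e := by rw [hdiv, zero_add]
  have hqmem : ∀ γ ∈ C ∩ {α : X | Dominates α.1 D}, q.eval₂ D.subtype f ∈ γ.1 :=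
    fun γ hγ => eval₂_subtype_mem hγ.2.1 (hf γ hγ) q
  have hqunit : ∀ γ ∈ C ∩ {α : X | Dominates α.1 D}, MemMaxIdeal γ.1 f →
      ¬ MemMaxIdeal γ.1 (q.eval₂ D.subtype f) := by
    intro γ hγ hfγ hqγ
    have := hX.isLocalRing γ.2
    refine he ((hγ.2.2 _ (p.coeff e).2).2 ?_)
    rw [← Polynomial.divX_mul_X_add q, Polynomial.eval₂_add, Polynomial.eval₂_mul,
      Polynomial.eval₂_X, Polynomial.eval₂_C, hq0] at hqγ
    have h2 := hqγ.sub (hfγ.mul_left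
      (eval₂_subtype_mem (p := q.divX) hγ.2.1 (hf γ hγ)))
    simpa using h2
  have hqnon : ∀ γ ∈ C ∩ {α : X | Dominates α.1 D}, ¬ MemMaxIdeal γ.1 f →
      MemMaxIdeal γ.1 (q.eval₂ D.subtype f) := by
    intro γ hγ hfγ
    have := hX.isLocalRing γ.2
    have h1 := (hp γ hγ).sub (MemMaxIdeal.eval₂_of_coeff hγ.2 (hf γ hγ) hlow)
    rw [Polynomial.eval₂_sub, sub_sub_cancel, Polynomial.eval₂_mul, Polynomial.eval₂_X_pow] at h1
    have h2 := h1.mul_left (γ.1.pow_mem (inv_mem_of_not_memMaxIdeal (hf γ hγ) hfγ) e)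
    rwa [inv_pow, inv_mul_cancel_left₀ (pow_ne_zero e hf0)] at h2
  have hqne : q.eval₂ D.subtype f ≠ 0 := ne_zero_of_not_memMaxIdeal (hqunit α hα hfα)
  obtain ⟨γ, hγ, hγ1, hγ2⟩ := hconn _ _ (isOpen_zariskiTop_setOf_mem f⁻¹)
    (isOpen_zariskiTop_setOf_mem (q.eval₂ D.subtype f)⁻¹)
    (fun γ hγ => by
      by_cases h : MemMaxIdeal γ.1 f
      · exact Or.inr (inv_mem_of_not_memMaxIdeal (hqmem γ hγ) (hqunit γ hγ h))
      · exact Or.inl (inv_mem_of_not_memMaxIdeal (hf γ hγ) h))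
    ⟨β, hβ, inv_mem_of_not_memMaxIdeal (hf β hβ) hfβ⟩
    ⟨α, hα, inv_mem_of_not_memMaxIdeal (hqmem α hα) (hqunit α hα hfα)⟩
  exact (hqnon γ hγ fun h => h.not_inv_mem hf0 hγ1).not_inv_mem hqne hγ2

end ClosedFibre

/-- Let `D` be a local subring of `F` with Noetherian prime spectrum, `X` a projective
model of `F/D`, and `Y` a nonempty Zariski closed and connected subset of the set of
members of `X` dominating `D`. Then `A(Y)` is a local ring dominated by every member
of `Y`. -/
theorem statement16 (D : Subring F) (hD : IsLocalRing D)
    (hNoeth : TopologicalSpace.NoetherianSpace (PrimeSpectrum D))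
    (X : Set (Subring F)) (hX : IsProjModel D X)
    (Y : Set ↥X) (hne : Y.Nonempty)
    (hYdom : ∀ α ∈ Y, Dominates α.1 D)
    (hYclosed : ∃ C : Set ↥X, @IsClosed _ (zariskiTop X) C ∧
      Y = C ∩ {α : ↥X | Dominates α.1 D})
    (hYconn : @IsConnected _ (zariskiTop X) Y) :
    IsLocalRing ↥(sInf (Subtype.val '' Y)) ∧
    ∀ α ∈ Y, Dominates α.1 (sInf (Subtype.val '' Y)) := by
  obtain ⟨C, hC, rfl⟩ := hYclosed
  set Y := C ∩ {α : ↥X | Dominates α.1 D}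
  set A := sInf (Subtype.val '' Y)
  have hAmem : ∀ f, f ∈ A ↔ ∀ α ∈ Y, f ∈ α.1 := by
    intro f
    rw [Subring.mem_sInf, Set.forall_mem_image]
  have hAle : ∀ α ∈ Y, A ≤ α.1 := fun α hα f hf => (hAmem f).1 hf α hα
  have hiff : ∀ f ∈ A, ∀ α ∈ Y, (MemMaxIdeal A f ↔ MemMaxIdeal α.1 f) := by
    intro f hf α hα
    refine ⟨fun h => ?_, fun h => h.of_le (hAle α hα) hf⟩
    by_contra hα'
    have hf0 : f ≠ 0 := ne_zero_of_not_memMaxIdeal hα'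
    refine h.not_inv_mem hf0 ((hAmem _).2 fun β hβ => ?_)
    exact inv_mem_of_not_memMaxIdeal (hAle β hβ hf) fun hβ' =>
      hα' (memMaxIdeal_of_isPreconnected hX hC hYconn.2 ((hAmem f).1 hf) hβ hα hβ')
  refine ⟨?_, fun α hα => ⟨hAle α hα, fun f hf => hiff f hf α hα⟩⟩
  obtain ⟨α, hα⟩ := hne
  have := hX.isLocalRing α.2
  refine IsLocalRing.of_nonunits_add fun a b ha hb hab => ?_
  have h := ((hiff a a.2 α hα).1 ⟨a.2, ha⟩).add ((hiff b b.2 α hα).1 ⟨b.2, hb⟩)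
  exact ((hiff _ (a + b).2 α hα).2 h).2 hab
end

section
/- Let F be a field and let D be a local subring of F that is not a field. If Z is a nonempty connected subspace of Dom_F(D) (in the Zariski topology), then there exists a local subring B of A(Z) that is integrally closed in F such that A(Z) is contained in the complete integral closure of B in F. -/
/-!
Common definitions: valuation rings of a field, the Zariski--Riemann space
`Zar_F(D)` with its Zariski and patch topologies, domination of local subrings,
residual algebraicity, integral closedness, and projective models of `F/D`.
-/

variable {F : Type*} [Field F]

/-- `x ∈ F` is almost integral over the subring `B`: there is a nonzero `c ∈ B` with
`c·xⁿ ∈ B` for all `n ≥ 1`. The complete integral closure of `B` in `F` is the set of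
such elements. -/
def AlmostIntegralOver (B : Subring F) (x : F) : Prop :=
  ∃ c : F, c ∈ B ∧ c ≠ 0 ∧ ∀ n : ℕ, 1 ≤ n → c * x ^ n ∈ B

section FamilyOfValuationSubrings

open Polynomial

variable {ι : Type*} (v : ι → ValuationSubring F)

/-- The elements of `F` lying in the maximal ideal of every valuation ring of the family. -/
def commonMaxIdeal : AddSubgroup F where
  carrier := {x | ∀ i, (v i).valuation x < 1}
  zero_mem' i := by simp
  add_mem' hx hy i := (v i).valuation.map_add_lt (hx i) (hy i)
  neg_mem' hx i := by simpa [Valuation.map_neg] using hx i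

theorem mem_commonMaxIdeal {x : F} :
    x ∈ commonMaxIdeal v ↔ ∀ i, (v i).valuation x < 1 := Iff.rfl

variable {v}

theorem mul_mem_commonMaxIdeal {x y : F} (hx : x ∈ commonMaxIdeal v) (hy : ∀ i, y ∈ v i) :
    x * y ∈ commonMaxIdeal v := fun i => by
  rw [map_mul]
  exact mul_lt_one_of_nonneg_of_lt_one_left zero_le (hx i)
    (((v i).valuation_le_one_iff y).2 (hy i))

theorem mem_of_mem_commonMaxIdeal {x : F} (hx : x ∈ commonMaxIdeal v) (i : ι) : x ∈ v i :=
  ((v i).valuation_le_one_iff x).1 (hx i).le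

variable (v) in
/-- The subring `D + J` of `F`, where `J` is the common part of the maximal ideals of a family
of valuation rings containing `D`. -/
def addCommonMaxIdeal (D : Subring F) (hD : ∀ i, ∀ x ∈ D, x ∈ v i) : Subring F where
  carrier := {x | ∃ d ∈ D, x - d ∈ commonMaxIdeal v}
  one_mem' := ⟨1, D.one_mem, by simp⟩
  zero_mem' := ⟨0, D.zero_mem, by simp⟩
  neg_mem' := by
    rintro x ⟨d, hd, hx⟩
    refine ⟨-d, D.neg_mem hd, ?_⟩
    simpa [neg_add_eq_sub] using neg_mem hx
  add_mem' := by
    rintro x y ⟨d, hd, hx⟩ ⟨e, he, hy⟩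
    refine ⟨d + e, D.add_mem hd he, ?_⟩
    simpa [add_sub_add_comm] using add_mem hx hy
  mul_mem' := by
    rintro x y ⟨d, hd, hx⟩ ⟨e, he, hy⟩
    refine ⟨d * e, D.mul_mem hd he, ?_⟩
    have hyA : ∀ i, y ∈ v i := fun i => by
      simpa using (v i).add_mem _ _ (mem_of_mem_commonMaxIdeal hy i) (hD i e he)
    have := add_mem (mul_mem_commonMaxIdeal hx hyA)
      (mul_mem_commonMaxIdeal hy fun i => hD i d hd)
    convert this using 1
    ring

variable {D : Subring F} {hD : ∀ i, ∀ x ∈ D, x ∈ v i}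

theorem mem_addCommonMaxIdeal_of_mem_commonMaxIdeal {x : F} (hx : x ∈ commonMaxIdeal v) :
    x ∈ addCommonMaxIdeal v D hD := ⟨0, D.zero_mem, by simpa using hx⟩

theorem mem_of_mem_addCommonMaxIdeal {x : F} (hx : x ∈ addCommonMaxIdeal v D hD) (i : ι) :
    x ∈ v i := by
  obtain ⟨d, hd, hx⟩ := hx
  simpa using (v i).add_mem _ _ (mem_of_mem_commonMaxIdeal hx i) (hD i d hd)

theorem inv_mem_of_valuation_eq_one {V : ValuationSubring F} {x : F} (hx : V.valuation x = 1) :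
    x⁻¹ ∈ V := (V.valuation_le_one_iff _).1 (by simp [hx])

theorem valuation_eq_one_of_inv_mem {V : ValuationSubring F} {x : F} (hx0 : x ≠ 0)
    (hx : x ∈ V) (hx' : x⁻¹ ∈ V) : V.valuation x = 1 := by
  refine le_antisymm ((V.valuation_le_one_iff _).2 hx) ?_
  have h := (V.valuation_le_one_iff _).2 hx'
  rw [map_inv₀] at h
  exact (inv_le_one₀ (by simpa [zero_lt_iff] using hx0)).1 h

/-- An element of `D + J` is either in `J` or a unit of `D + J`. -/
theorem mem_commonMaxIdeal_or_inv_mem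
    (hdich : ∀ d ∈ D, d ∈ commonMaxIdeal v ∨ d ≠ 0 ∧ d⁻¹ ∈ D)
    {x : F} (hx : x ∈ addCommonMaxIdeal v D hD) :
    x ∈ commonMaxIdeal v ∨
      (∀ i, (v i).valuation x = 1) ∧ x⁻¹ ∈ addCommonMaxIdeal v D hD := by
  obtain ⟨d, hd, hxd⟩ := hx
  rcases hdich d hd with hdJ | ⟨hd0, hdinv⟩
  · left
    simpa using add_mem hxd hdJ
  · right
    have hv : ∀ i, (v i).valuation d = 1 := fun i =>
      valuation_eq_one_of_inv_mem hd0 (hD i d hd) (hD i _ hdinv)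
    have hvx : ∀ i, (v i).valuation x = 1 := fun i => by
      have := (v i).valuation.map_add_eq_of_lt_right (x := x - d) (y := d)
        (by rw [hv i]; exact hxd i)
      rw [sub_add_cancel] at this
      rw [this, hv i]
    refine ⟨hvx, d⁻¹, hdinv, fun i => ?_⟩
    have hx0 : x ≠ 0 := by
      rintro rfl
      simpa using hvx i
    rw [inv_sub_inv hx0 hd0, map_div₀, map_mul, hvx i, hv i, mul_one, div_one,
      Valuation.map_sub_swap]
    exact hxd i

variable (v D hD) in
/-- The integral closure of `D + J` in `F`. -/
def integralClosureAddCommonMaxIdeal : Subring F :=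
  (integralClosure (addCommonMaxIdeal v D hD) F).toSubring

theorem mem_integralClosureAddCommonMaxIdeal {x : F} :
    x ∈ integralClosureAddCommonMaxIdeal v D hD ↔ IsIntegral (addCommonMaxIdeal v D hD) x :=
  Iff.rfl

theorem addCommonMaxIdeal_le :
    addCommonMaxIdeal v D hD ≤ integralClosureAddCommonMaxIdeal v D hD := fun x hx =>
  mem_integralClosureAddCommonMaxIdeal.2 <|
    isIntegral_algebraMap (R := addCommonMaxIdeal v D hD) (A := F) (x := ⟨x, hx⟩)

theorem mem_of_mem_integralClosureAddCommonMaxIdeal {x : F}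
    (hx : x ∈ integralClosureAddCommonMaxIdeal v D hD) (i : ι) : x ∈ v i := by
  obtain ⟨p, hp, hpx⟩ := mem_integralClosureAddCommonMaxIdeal.1 hx
  let f : addCommonMaxIdeal v D hD →+* v i :=
    Subring.inclusion (T := (v i).toSubring) fun y hy => mem_of_mem_addCommonMaxIdeal hy i
  have hint : IsIntegral (v i) x := by
    refine ⟨p.map f, hp.map f, ?_⟩
    rw [eval₂_map]
    exact hpx
  obtain ⟨y, rfl⟩ := IsIntegrallyClosed.isIntegral_iff.1 hint
  exact y.2

theorem integrallyClosedIn_integralClosureAddCommonMaxIdeal :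
    IntegrallyClosedIn (integralClosureAddCommonMaxIdeal v D hD) := by
  rintro x ⟨p, hp, hcoeff, hpx⟩
  have hsub : (↑p.coeffs : Set F) ⊆ integralClosure (addCommonMaxIdeal v D hD) F := by
    intro y hy
    obtain ⟨n, -, rfl⟩ := Polynomial.mem_coeffs_iff.1 hy
    exact hcoeff n
  have hint : IsIntegral (integralClosure (addCommonMaxIdeal v D hD) F) x := by
    refine ⟨p.toSubring (integralClosure (addCommonMaxIdeal v D hD) F).toSubring hsub,
      (monic_toSubring _ _ _).2 hp, ?_⟩
    rw [← hpx, eval₂_eq_eval_map]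
    congr 1
    exact map_toSubring p (integralClosure (addCommonMaxIdeal v D hD) F).toSubring hsub
  exact isIntegral_trans x hint

/-- Modulo `J`, the value at `x` of a polynomial having a unit coefficient factors as a power of
`x` times an element that is a unit modulo `x`. -/
theorem exists_eval_sub_mem_commonMaxIdeal
    (hdich : ∀ d ∈ D, d ∈ commonMaxIdeal v ∨ d ≠ 0 ∧ d⁻¹ ∈ D)
    {x : F} (hx : x ∈ integralClosureAddCommonMaxIdeal v D hD) (n : ℕ) :
    ∀ p : (addCommonMaxIdeal v D hD)[X], (p.coeff n : F) ∉ commonMaxIdeal v →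
      ∃ k : ℕ, ∃ u h : F, (∀ i, (v i).valuation u = 1) ∧ u⁻¹ ∈ addCommonMaxIdeal v D hD ∧
        h ∈ integralClosureAddCommonMaxIdeal v D hD ∧
        aeval x p - x ^ k * (u + x * h) ∈ commonMaxIdeal v := by
  have heval : ∀ p : (addCommonMaxIdeal v D hD)[X],
      aeval x p = aeval x p.divX * x + (p.coeff 0 : F) := fun p => by
    conv_lhs => rw [← divX_mul_X_add p]
    simp only [map_add, map_mul, aeval_X, aeval_C]
    rfl
  have hconst : ∀ p : (addCommonMaxIdeal v D hD)[X], (p.coeff 0 : F) ∉ commonMaxIdeal v →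
      ∃ k : ℕ, ∃ u h : F, (∀ i, (v i).valuation u = 1) ∧ u⁻¹ ∈ addCommonMaxIdeal v D hD ∧
        h ∈ integralClosureAddCommonMaxIdeal v D hD ∧
        aeval x p - x ^ k * (u + x * h) ∈ commonMaxIdeal v := by
    intro p hp
    obtain ⟨hu, huinv⟩ := (mem_commonMaxIdeal_or_inv_mem hdich (p.coeff 0).2).resolve_left hp
    refine ⟨0, p.coeff 0, aeval x p.divX, hu, huinv,
      Algebra.adjoin_le (S := integralClosure (addCommonMaxIdeal v D hD) F)
        (Set.singleton_subset_iff.2 hx) (aeval_mem_adjoin_singleton _ _), ?_⟩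
    have : aeval x p - x ^ 0 * ((p.coeff 0 : F) + x * aeval x p.divX) = 0 := by
      rw [heval p]
      ring
    rw [this]
    exact zero_mem _
  induction n with
  | zero => exact hconst
  | succ n ih =>
    intro p hp
    by_cases h0 : (p.coeff 0 : F) ∈ commonMaxIdeal v
    · obtain ⟨k, u, h, hu, huinv, hh, hJ⟩ := ih p.divX (by rwa [coeff_divX])
      refine ⟨k + 1, u, h, hu, huinv, hh, ?_⟩
      convert add_mem (mul_mem_commonMaxIdeal hJ
        (mem_of_mem_integralClosureAddCommonMaxIdeal hx)) h0 using 1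
      rw [heval p]
      ring
    · exact hconst p h0

/-- If the family cannot be split into two nonempty disjoint basic open pieces, then an element of
the integral closure of `D + J` in `F` is either in `J` or invertible. -/
theorem mem_commonMaxIdeal_or_inv_mem_integralClosure
    (hdich : ∀ d ∈ D, d ∈ commonMaxIdeal v ∨ d ≠ 0 ∧ d⁻¹ ∈ D)
    (hconn : ∀ a b : F, (∀ i, a ∈ v i ∨ b ∈ v i) → (∀ i, ¬ (a ∈ v i ∧ b ∈ v i)) →
      (∀ i, a ∈ v i) ∨ ∀ i, b ∈ v i) [Nonempty ι]
    {x : F} (hx : x ∈ integralClosureAddCommonMaxIdeal v D hD) :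
    x ∈ commonMaxIdeal v ∨ x ≠ 0 ∧ x⁻¹ ∈ integralClosureAddCommonMaxIdeal v D hD := by
  rcases eq_or_ne x 0 with rfl | hx0
  · exact Or.inl (zero_mem _)
  obtain ⟨p, hp, hpx⟩ := mem_integralClosureAddCommonMaxIdeal.1 hx
  obtain ⟨k, u, h, hu, huinv, hh, hJ⟩ := exists_eval_sub_mem_commonMaxIdeal hdich hx
    p.natDegree p (by
      rw [hp.coeff_natDegree, mem_commonMaxIdeal]
      simp)
  rw [aeval_def, hpx, zero_sub, neg_mem_iff] at hJ
  have hxA := mem_of_mem_integralClosureAddCommonMaxIdeal hx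
  have hhA := mem_of_mem_integralClosureAddCommonMaxIdeal hh
  set y := u + x * h with hy
  have hyeq : ∀ i, (v i).valuation x < 1 → (v i).valuation y = 1 := fun i hi => by
    have hlt : (v i).valuation (x * h) < 1 := by
      rw [map_mul]
      exact mul_lt_one_of_nonneg_of_lt_one_left zero_le hi
        (((v i).valuation_le_one_iff h).2 (hhA i))
    rw [hy, (v i).valuation.map_add_eq_of_lt_left (by rwa [hu i]), hu i]
  have hylt : ∀ i, (v i).valuation x = 1 → (v i).valuation y < 1 := fun i hi => by
    simpa [hi] using hJ i
  have hxle : ∀ i, (v i).valuation x < 1 ∨ (v i).valuation x = 1 := fun i =>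
    (((v i).valuation_le_one_iff x).2 (hxA i)).lt_or_eq
  have hyA : ∀ i, y ∈ v i := fun i => ((v i).valuation_le_one_iff y).1 <|
    (hxle i).elim (fun hi => (hyeq i hi).le) fun hi => (hylt i hi).le
  have hsplit : x ∈ commonMaxIdeal v ∨ ∀ i, (v i).valuation x = 1 := by
    rcases eq_or_ne y 0 with hy0 | hy0
    · right
      refine fun i => (hxle i).resolve_left fun hi => ?_
      simpa [hy0] using hyeq i hi
    · rcases hconn x⁻¹ y⁻¹
        (fun i => (hxle i).elim (fun hi => Or.inr (inv_mem_of_valuation_eq_one (hyeq i hi)))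
          fun hi => Or.inl (inv_mem_of_valuation_eq_one hi))
        (fun i ⟨hxi, hyi⟩ => (hylt i (valuation_eq_one_of_inv_mem hx0 (hxA i) hxi)).ne
          (valuation_eq_one_of_inv_mem hy0 (hyA i) hyi)) with hall | hall
      · exact Or.inr fun i => valuation_eq_one_of_inv_mem hx0 (hxA i) (hall i)
      · exact Or.inl fun i => (hxle i).resolve_right fun hi =>
          (hylt i hi).ne (valuation_eq_one_of_inv_mem hy0 (hyA i) (hall i))
  refine hsplit.imp_right fun hx1 => ⟨hx0, ?_⟩
  have hyx : y * x⁻¹ ∈ commonMaxIdeal v :=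
    mul_mem_commonMaxIdeal (fun i => hylt i (hx1 i)) fun i => inv_mem_of_valuation_eq_one (hx1 i)
  have hu0 : u ≠ 0 := by
    rintro rfl
    simpa using hu (Classical.arbitrary ι)
  have hinv : x⁻¹ = u⁻¹ * (y * x⁻¹ - h) := by
    rw [hy]
    field_simp
    ring
  rw [hinv]
  exact Subring.mul_mem _ (addCommonMaxIdeal_le huinv) (Subring.sub_mem _
    (addCommonMaxIdeal_le (mem_addCommonMaxIdeal_of_mem_commonMaxIdeal hyx)) hh)

theorem isLocalRing_integralClosureAddCommonMaxIdeal
    (hdich : ∀ d ∈ D, d ∈ commonMaxIdeal v ∨ d ≠ 0 ∧ d⁻¹ ∈ D)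
    (hconn : ∀ a b : F, (∀ i, a ∈ v i ∨ b ∈ v i) → (∀ i, ¬ (a ∈ v i ∧ b ∈ v i)) →
      (∀ i, a ∈ v i) ∨ ∀ i, b ∈ v i) [Nonempty ι] :
    IsLocalRing (integralClosureAddCommonMaxIdeal v D hD) := by
  refine IsLocalRing.of_isUnit_or_isUnit_one_sub_self fun x => ?_
  have key : ∀ y : integralClosureAddCommonMaxIdeal v D hD,
      (y : F) ∈ commonMaxIdeal v ∨ IsUnit y := fun y =>
    (mem_commonMaxIdeal_or_inv_mem_integralClosure hdich hconn y.2).imp_right fun ⟨h0, hinv⟩ =>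
      IsUnit.of_mul_eq_one ⟨_, hinv⟩ (Subtype.ext (mul_inv_cancel₀ h0))
  rcases key x with hx | hx
  · rcases key (1 - x) with hx' | hx'
    · have h1 : (1 : F) ∈ commonMaxIdeal v := by simpa using add_mem hx hx'
      simpa using h1 (Classical.arbitrary ι)
    · exact Or.inr hx'
  · exact Or.inl hx

theorem almostIntegralOver_integralClosureAddCommonMaxIdeal
    {c : F} (hc : c ∈ commonMaxIdeal v) (hc0 : c ≠ 0) {x : F} (hx : ∀ i, x ∈ v i) :
    AlmostIntegralOver (integralClosureAddCommonMaxIdeal v D hD) x :=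
  have hmem : ∀ {z : F}, z ∈ commonMaxIdeal v → z ∈ integralClosureAddCommonMaxIdeal v D hD :=
    fun hz => addCommonMaxIdeal_le (mem_addCommonMaxIdeal_of_mem_commonMaxIdeal hz)
  ⟨c, hmem hc, hc0, fun n _ => hmem (mul_mem_commonMaxIdeal hc fun i => pow_mem (hx i) n)⟩

end FamilyOfValuationSubrings

/-- The bundled valuation subring attached to a subring that is a valuation ring of `F`. -/
def IsValSubring.toValuationSubring {V : Subring F} (hV : IsValSubring V) :
    ValuationSubring F where
  toSubring := V
  mem_or_inv_mem' x := by
    rcases eq_or_ne x 0 with rfl | hx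
    · exact Or.inl V.zero_mem
    · exact hV x hx

theorem IsValSubring.valuation_lt_one {V : Subring F} (hV : IsValSubring V) {x : F}
    (hx : MemMaxIdeal V x) : hV.toValuationSubring.valuation x < 1 := by
  obtain ⟨h, hu⟩ := hx
  exact (hV.toValuationSubring.valuation_lt_one_iff ⟨x, h⟩).1
    ((IsLocalRing.mem_maximalIdeal _).2 hu)

theorem isOpen_setOf_mem_zariskiTop (X : Set (Subring F)) (a : F) :
    @IsOpen _ (zariskiTop X) {R : X | a ∈ (R : Subring F)} :=
  TopologicalSpace.isOpen_generateFrom_of_mem ⟨{a}, by simp⟩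

/-- Let `D` be a local subring of `F` that is not a field. If `Z` is a nonempty
connected subspace of `Dom_F(D)` in the Zariski topology, then there is a local
subring `B` of `A(Z)` that is integrally closed in `F` and whose complete integral
closure in `F` contains `A(Z)`. -/
theorem statement18 (D : Subring F) (hD : IsLocalRing D) (hnf : ¬ IsField D)
    (Z : Set ↥(domSet D)) (hne : Z.Nonempty)
    (hconn : @IsConnected _ (zariskiTop (domSet D)) Z) :
    ∃ B : Subring F, IsLocalRing B ∧ IntegrallyClosedIn B ∧
      B ≤ sInf (Subtype.val '' Z) ∧
      ∀ x ∈ sInf (Subtype.val '' Z), AlmostIntegralOver B x := by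
  let v : Z → ValuationSubring F := fun V => V.1.2.1.toValuationSubring
  have hDv : ∀ i, ∀ x ∈ D, x ∈ v i := fun V x hx => V.1.2.2.1 hx
  have : Nonempty Z := hne.to_subtype
  have hmax : ∀ d ∈ D, MemMaxIdeal D d → d ∈ commonMaxIdeal v := fun d hd hdm V =>
    V.1.2.1.valuation_lt_one ((V.1.2.2.2 d hd).1 hdm)
  have hdich : ∀ d ∈ D, d ∈ commonMaxIdeal v ∨ d ≠ 0 ∧ d⁻¹ ∈ D := by
    intro d hd
    by_cases hu : IsUnit (⟨d, hd⟩ : D)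
    · right
      obtain ⟨e, he⟩ := hu.exists_right_inv
      have he' : d * (e : F) = 1 := congrArg Subtype.val he
      exact ⟨left_ne_zero_of_mul_eq_one he', by
        rw [inv_eq_of_mul_eq_one_right he']
        exact e.2⟩
    · exact Or.inl (hmax d hd ⟨hd, hu⟩)
  have hsplit : ∀ a b : F, (∀ i, a ∈ v i ∨ b ∈ v i) → (∀ i, ¬ (a ∈ v i ∧ b ∈ v i)) →
      (∀ i, a ∈ v i) ∨ ∀ i, b ∈ v i := by
    intro a b hcover hdisj
    let _ := zariskiTop (domSet D)
    by_contra! hcon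
    obtain ⟨⟨i, hi⟩, ⟨j, hj⟩⟩ := hcon
    obtain ⟨V, hVZ, hVa, hVb⟩ := hconn.isPreconnected _ _
      (isOpen_setOf_mem_zariskiTop (domSet D) a) (isOpen_setOf_mem_zariskiTop (domSet D) b)
      (fun V hV => hcover ⟨V, hV⟩)
      ⟨j, j.2, (hcover j).resolve_right hj⟩ ⟨i, i.2, (hcover i).resolve_left hi⟩
    exact hdisj ⟨V, hVZ⟩ ⟨hVa, hVb⟩
  obtain ⟨c, hc0, hcu⟩ : ∃ c : D, c ≠ 0 ∧ ¬ IsUnit c := by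
    by_contra! hcon
    exact hnf ⟨⟨0, 1, zero_ne_one⟩, mul_comm, fun {a} ha => (hcon a ha).exists_right_inv⟩
  refine ⟨integralClosureAddCommonMaxIdeal v D hDv,
    isLocalRing_integralClosureAddCommonMaxIdeal hdich hsplit,
    integrallyClosedIn_integralClosureAddCommonMaxIdeal, ?_, fun x hx => ?_⟩
  · refine le_sInf ?_
    rintro _ ⟨V, hV, rfl⟩ x hx
    exact mem_of_mem_integralClosureAddCommonMaxIdeal hx ⟨V, hV⟩
  · exact almostIntegralOver_integralClosureAddCommonMaxIdeal
      (hmax c c.2 ⟨c.2, hcu⟩) (by simpa using hc0)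
      fun V => Subring.mem_sInf.1 hx _ ⟨V.1, V.2, rfl⟩
end
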